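/- arXiv:2311.01706 — 2 statements merged into one kernel-verified Lean document; each statement's English description precedes it below -/
import Mathlib

section
/- Let R be a commutative Noetherian ring, M a finitely generated R-module, and N a proper submodule of M. If N = M_0 ⊂ M_1 ⊂ ⋯ ⊂ M_n = M is a regular prime extension filtration of M over N with prime ideals p_1, …, p_n, then for each 1 ≤ i ≤ n, M_i = {x ∈ M : p_1 p_2 ⋯ p_i x ⊆ N}; that is, M_i = (N :_M p_1 p_2 ⋯ p_i). -/
open Submodule

section Defs

variable {R : Type*} [CommRing R] {M : Type*} [AddCommGroup M] [Module R M]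

/-- `K` is a `p`-prime extension of `N` (i.e. `N` is a `p`-prime submodule of `K`):
`(N : K) = p` and for all `a : R`, `x ∈ K`, `a • x ∈ N` implies `a ∈ p` or `x ∈ N`. -/
def IsPrimeExtension (p : Ideal R) (N K : Submodule R M) : Prop :=
  p.IsPrime ∧ N ≤ K ∧ N.colon K = p ∧
    ∀ (a : R) (x : M), x ∈ K → a • x ∈ N → a ∈ p ∨ x ∈ N

/-- `K` is a maximal `p`-prime extension of `N` in the ambient module: no `p`-prime
extension of `N` properly contains `K`. -/
def IsMaximalPrimeExtension (p : Ideal R) (N K : Submodule R M) : Prop :=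
  IsPrimeExtension p N K ∧ ∀ L : Submodule R M, IsPrimeExtension p N L → ¬ K < L

/-- `K` is a regular `p`-prime extension of `N` in the ambient module: `K` is a maximal
`p`-prime extension of `N` and `p` is a maximal element of `Ass(M/N)`. -/
def IsRegularPrimeExtension (p : Ideal R) (N K : Submodule R M) : Prop :=
  IsMaximalPrimeExtension p N K ∧ p ∈ associatedPrimes R (M ⧸ N) ∧
    ∀ q ∈ associatedPrimes R (M ⧸ N), p ≤ q → q = p

/-- `F 0 = N ⊂ F 1 ⊂ ⋯ ⊂ F n = M` is a regular prime extension (RPE) filtration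
of the ambient module over `N`, with prime ideals `p 0, …, p (n-1)`. -/
def IsRPEFiltration (N : Submodule R M) (n : ℕ) (F : Fin (n + 1) → Submodule R M)
    (p : Fin n → Ideal R) : Prop :=
  F 0 = N ∧ F (Fin.last n) = ⊤ ∧
    ∀ i : Fin n, IsRegularPrimeExtension (p i) (F i.castSucc) (F i.succ)

/-- `N` has generalized prime ideal factorization given by the multiset `S` of primes. -/
def HasPFactorization (N : Submodule R M) (S : Multiset (Ideal R)) : Prop :=
  ∃ (n : ℕ) (F : Fin (n + 1) → Submodule R M) (p : Fin n → Ideal R),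
    IsRPEFiltration N n F p ∧ (List.ofFn p : Multiset (Ideal R)) = S

end Defs

/-- If `p` is a maximal element of `Ass(M/N)`, then `(N :_M p)` is a `p`-prime extension of `N`,
so the regular `p`-prime extensions of `N` are equal to it. -/
theorem IsRegularPrimeExtension.mem_iff {R : Type*} [CommRing R] [IsNoetherianRing R]
    {M : Type*} [AddCommGroup M] [Module R M] {p : Ideal R} {N K : Submodule R M}
    (h : IsRegularPrimeExtension p N K) (x : M) :
    x ∈ K ↔ ∀ a ∈ p, a • x ∈ N := by
  obtain ⟨⟨⟨hp, -, hcolon, -⟩, hmax⟩, hass, hassmax⟩ := h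
  let L : Submodule R M :=
    { carrier := {y | ∀ a ∈ p, a • y ∈ N}
      zero_mem' := fun a _ => by simp
      add_mem' := fun hy hz a ha => by
        rw [smul_add]
        exact N.add_mem (hy a ha) (hz a ha)
      smul_mem' := fun c y hy a ha => by
        rw [smul_comm]
        exact N.smul_mem c (hy a ha) }
  have hKL : K ≤ L := fun y hy a ha => by
    rw [← hcolon, mem_colon] at ha
    exact ha y hy
  have hL : IsPrimeExtension p N L := by
    refine ⟨hp, fun y hy a _ => N.smul_mem a hy, ?_, fun a y hy hay => ?_⟩
    · refine le_antisymm (fun a ha => ?_) fun a ha => mem_colon.2 fun y hy => hy a ha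
      obtain ⟨-, z, hz⟩ := isAssociatedPrime_iff.1 hass
      obtain ⟨y, rfl⟩ := N.mkQ_surjective z
      have key : ∀ b : R, b ∈ p ↔ b • y ∈ N := fun b => by
        rw [hz, mem_colon_singleton, ← map_smul, mem_bot, mkQ_apply, Quotient.mk_eq_zero]
      exact (key a).2 (mem_colon.1 ha y fun b hb => (key b).1 hb)
    · by_contra! hcon
      obtain ⟨hap, hyN⟩ := hcon
      obtain ⟨q, hq, hle⟩ := exists_le_isAssociatedPrime_of_isNoetherianRing R (N.mkQ y)
        (by rwa [mkQ_apply, Ne, Quotient.mk_eq_zero])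
      have key : ∀ b : R, b • y ∈ N → b ∈ q := fun b hb => hle <| by
        rwa [mem_colon_singleton, ← map_smul, mem_bot, mkQ_apply, Quotient.mk_eq_zero]
      have hqp := hassmax q hq fun b hb => key b (hy b hb)
      exact hap (hqp ▸ key a hay)
  have hKeq : K = L := eq_of_le_of_not_lt hKL (hmax L hL)
  rw [hKeq]
  exact Iff.rfl

/-- Membership in `((N :_M I) :_M J)` is membership in `(N :_M I * J)`. -/
theorem forall_mem_mul_smul_mem_iff {R : Type*} [CommRing R] {M : Type*} [AddCommGroup M]
    [Module R M] (I J : Ideal R) (N : Submodule R M) (x : M) :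
    (∀ r ∈ I * J, r • x ∈ N) ↔ ∀ b ∈ J, ∀ a ∈ I, a • b • x ∈ N := by
  have h := Ideal.mul_le (I := I) (J := J) (K := N.colon {x})
  simp only [SetLike.le_def, mem_colon_singleton, mul_smul] at h
  exact ⟨fun H b hb a ha => h.1 (fun {r} hr => H r hr) a ha b hb,
    fun H r hr => h.2 (fun a ha b hb => H b hb a ha) hr⟩

theorem IsRPEFiltration.mem_iff {R : Type*} [CommRing R] [IsNoetherianRing R]
    {M : Type*} [AddCommGroup M] [Module R M] {N : Submodule R M} {n : ℕ}
    {F : Fin (n + 1) → Submodule R M} {p : Fin n → Ideal R} (hF : IsRPEFiltration N n F p)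
    (k : Fin (n + 1)) : ∀ x : M,
      x ∈ F k ↔ ∀ r ∈ (∏ j with j.castSucc < k, p j : Ideal R), r • x ∈ N := by
  induction k using Fin.induction with
  | zero =>
    intro x
    rw [hF.1]
    simp only [Fin.not_lt_zero, Finset.filter_false, Finset.prod_empty, Ideal.one_eq_top]
    exact ⟨fun hx r _ => N.smul_mem r hx, fun h => by simpa using h 1 trivial⟩
  | succ i ih =>
    intro x
    have hset : (Finset.univ.filter fun j : Fin n => j.castSucc < i.succ) =
        insert i (Finset.univ.filter fun j : Fin n => j.castSucc < i.castSucc) := by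
      ext j
      simp [Fin.castSucc_lt_succ_iff, le_iff_eq_or_lt]
    rw [hset, Finset.prod_insert (by simp), mul_comm, forall_mem_mul_smul_mem_iff,
      (hF.2.2 i).mem_iff]
    simp only [ih]

/-- If `N = M_0 ⊂ M_1 ⊂ ⋯ ⊂ M_n = M` is an RPE filtration of `M` over a proper
submodule `N` with primes `p_1, …, p_n`, then `M_i = (N :_M p_1 ⋯ p_i)
= {x ∈ M : p_1 ⋯ p_i x ⊆ N}` for `1 ≤ i ≤ n`. -/
theorem stmt_1 {R : Type*} [CommRing R] [IsNoetherianRing R]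
    {M : Type*} [AddCommGroup M] [Module R M] [Module.Finite R M]
    (N : Submodule R M) (hN : N ≠ ⊤) (n : ℕ)
    (F : Fin (n + 1) → Submodule R M) (p : Fin n → Ideal R)
    (hF : IsRPEFiltration N n F p) :
    ∀ i : Fin n, ∀ x : M,
      x ∈ F i.succ ↔ ∀ r ∈ (∏ j ∈ Finset.Iic i, p j : Ideal R), r • x ∈ N := by
  intro i x
  rw [hF.mem_iff]
  have hset : (Finset.univ.filter fun j : Fin n => j.castSucc < i.succ) = Finset.Iic i := by
    ext j
    simp [Fin.castSucc_lt_succ_iff]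
  rw [hset]
end

section
/- Let R be a commutative Noetherian ring, M a finitely generated R-module, and N a proper submodule of M. Suppose N = M_0 ⊂ ⋯ ⊂ M_{i-1} ⊂ M_i ⊂ M_{i+1} ⊂ ⋯ ⊂ M_n = M is a regular prime extension filtration of M over N with prime ideals p_1, …, p_n, and suppose p_{i+1} ⊄ p_i. Then there exists a submodule K_i of M such that N = M_0 ⊂ ⋯ ⊂ M_{i-1} ⊂ K_i ⊂ M_{i+1} ⊂ ⋯ ⊂ M_n = M is a regular prime extension filtration of M over N, where K_i is a regular p_{i+1}-prime extension of M_{i-1} and M_{i+1} is a regular p_i-prime extension of K_i (i.e. the prime ideals p_i and p_{i+1} are interchanged). -/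
open Submodule

section Residual

variable {R : Type*} [CommRing R] {M : Type*} [AddCommGroup M] [Module R M]

/-- The residualSubmodule submodule `(N :_M I) = {x | I • x ⊆ N}`. -/
def residualSubmodule (N : Submodule R M) (I : Ideal R) : Submodule R M :=
  ⨅ a ∈ I, N.comap (LinearMap.lsmul R M a)

theorem mem_residualSubmodule {N : Submodule R M} {I : Ideal R} {x : M} :
    x ∈ residualSubmodule N I ↔ ∀ a ∈ I, a • x ∈ N := by
  simp [residualSubmodule]

theorem le_residualSubmodule (N : Submodule R M) (I : Ideal R) : N ≤ residualSubmodule N I :=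
  fun _ hx => mem_residualSubmodule.2 fun a _ => N.smul_mem a hx

theorem residualSubmodule_comm (N : Submodule R M) (I J : Ideal R) :
    residualSubmodule (residualSubmodule N I) J = residualSubmodule (residualSubmodule N J) I := by
  ext x
  simp only [mem_residualSubmodule]
  exact ⟨fun h a ha b hb => smul_comm a b x ▸ h b hb a ha,
    fun h a ha b hb => smul_comm a b x ▸ h b hb a ha⟩

theorem mem_associatedPrimes_quotient_iff [IsNoetherianRing R] {N : Submodule R M} {q : Ideal R} :
    q ∈ associatedPrimes R (M ⧸ N) ↔ q.IsPrime ∧ ∃ x : M, q = N.colon {x} := by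
  rw [AssociatedPrimes.mem_iff, isAssociatedPrime_iff, N.mkQ_surjective.exists]
  have (x : M) : (⊥ : Submodule R (M ⧸ N)).colon {N.mkQ x} = N.colon {x} := by
    ext r
    rw [mem_colon_singleton, mem_colon_singleton, ← map_smul, mem_bot, mkQ_apply,
      Submodule.Quotient.mk_eq_zero]
  simp only [this]

theorem exists_le_mem_associatedPrimes_quotient [IsNoetherianRing R] {N : Submodule R M} {x : M}
    (hx : x ∉ N) : ∃ q ∈ associatedPrimes R (M ⧸ N), N.colon {x} ≤ q := by
  obtain ⟨q, hq, hle⟩ := exists_le_isAssociatedPrime_of_isNoetherianRing R (N.mkQ x)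
    (by simpa using hx)
  refine ⟨q, hq, fun r hr => hle ?_⟩
  rw [mem_colon_singleton] at hr ⊢
  rw [← map_smul, mem_bot, mkQ_apply, Submodule.Quotient.mk_eq_zero]
  exact hr

theorem IsPrimeExtension.le_residualSubmodule {p : Ideal R} {N K : Submodule R M}
    (h : IsPrimeExtension p N K) : K ≤ residualSubmodule N p := by
  obtain ⟨-, -, rfl, -⟩ := h
  exact fun x hx => mem_residualSubmodule.2 fun a ha => mem_colon.1 ha x hx

theorem isPrimeExtension_residualSubmodule [IsNoetherianRing R] {p : Ideal R} {N : Submodule R M}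
    (hp : p ∈ associatedPrimes R (M ⧸ N))
    (hmax : ∀ q ∈ associatedPrimes R (M ⧸ N), p ≤ q → q = p) :
    IsPrimeExtension p N (residualSubmodule N p) := by
  obtain ⟨hprime, y, hy⟩ := mem_associatedPrimes_quotient_iff.1 hp
  refine ⟨hprime, le_residualSubmodule N p, le_antisymm (fun a ha => ?_) (fun a ha => ?_), ?_⟩
  · rw [hy, mem_colon_singleton]
    refine mem_colon.1 ha y (mem_residualSubmodule.2 fun b hb => ?_)
    rwa [hy, mem_colon_singleton] at hb
  · exact mem_colon.2 fun x hx => mem_residualSubmodule.1 hx a ha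
  · intro a x hx hax
    refine or_iff_not_imp_right.2 fun hxN => ?_
    obtain ⟨q, hq, hle⟩ := exists_le_mem_associatedPrimes_quotient hxN
    have hpq : p ≤ q := fun b hb => hle (mem_colon_singleton.2 (mem_residualSubmodule.1 hx b hb))
    exact hmax q hq hpq ▸ hle (mem_colon_singleton.2 hax)

theorem isRegularPrimeExtension_iff [IsNoetherianRing R] {p : Ideal R} {N K : Submodule R M} :
    IsRegularPrimeExtension p N K ↔ K = residualSubmodule N p ∧ p ∈ associatedPrimes R (M ⧸ N) ∧
      ∀ q ∈ associatedPrimes R (M ⧸ N), p ≤ q → q = p := by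
  refine and_congr_left fun ⟨hp, hmax⟩ => ⟨fun h => ?_, ?_⟩
  · exact h.1.le_residualSubmodule.eq_of_not_lt (h.2 _ (isPrimeExtension_residualSubmodule hp hmax))
  · rintro rfl
    exact ⟨isPrimeExtension_residualSubmodule hp hmax, fun L hL => hL.le_residualSubmodule.not_gt⟩

theorem associatedPrimes_quotient_residualSubmodule_subset [IsNoetherianRing R] (N : Submodule R M)
    (I : Ideal R) :
    associatedPrimes R (M ⧸ residualSubmodule N I) ⊆ associatedPrimes R (M ⧸ N) := by
  intro q hq
  obtain ⟨hprime, x, hx⟩ := mem_associatedPrimes_quotient_iff.1 hq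
  obtain ⟨s, rfl⟩ := IsNoetherian.noetherian I
  have hle : (s.inf fun a => N.colon {a • x}) ≤ q := by
    intro r hr
    rw [hx, mem_colon_singleton, mem_residualSubmodule]
    intro a ha
    have hs : Ideal.span (s : Set R) ≤ N.colon {r • x} := Ideal.span_le.2 fun b hb => by
      have := (Submodule.mem_finsetInf.1 hr) b hb
      rw [mem_colon_singleton, smul_comm] at this
      exact mem_colon_singleton.2 this
    exact mem_colon_singleton.1 (hs ha)
  obtain ⟨a, ha, haq⟩ := hprime.inf_le'.1 hle
  refine mem_associatedPrimes_quotient_iff.2 ⟨hprime, a • x, le_antisymm (fun r hr => ?_) haq⟩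
  rw [hx, mem_colon_singleton] at hr
  rw [mem_colon_singleton, smul_comm]
  exact mem_residualSubmodule.1 hr a (subset_span ha)

theorem mem_associatedPrimes_quotient_residualSubmodule [IsNoetherianRing R] {N : Submodule R M}
    {I q : Ideal R} (hq : q ∈ associatedPrimes R (M ⧸ N)) (hIq : ¬ I ≤ q) :
    q ∈ associatedPrimes R (M ⧸ residualSubmodule N I) := by
  obtain ⟨hprime, x, hx⟩ := mem_associatedPrimes_quotient_iff.1 hq
  refine mem_associatedPrimes_quotient_iff.2 ⟨hprime, x, le_antisymm (fun r hr => ?_) ?_⟩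
  · rw [hx, mem_colon_singleton] at hr
    exact mem_colon_singleton.2 (le_residualSubmodule N I hr)
  · intro r hr
    obtain ⟨a, haI, haq⟩ := SetLike.not_le_iff_exists.1 hIq
    rw [mem_colon_singleton, mem_residualSubmodule] at hr
    have har : a * r ∈ q := by
      rw [hx, mem_colon_singleton, mul_smul]
      exact hr a haI
    exact (hprime.mem_or_mem har).resolve_left haq

/-- Two successive regular prime extensions, by `p` and then by `q`, may be interchanged when
`q` is not contained in `p`. -/
theorem IsRegularPrimeExtension.interchange [IsNoetherianRing R] {p q : Ideal R}
    {A B C : Submodule R M} (hAB : IsRegularPrimeExtension p A B)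
    (hBC : IsRegularPrimeExtension q B C) (hqp : ¬ q ≤ p) :
    IsRegularPrimeExtension q A (residualSubmodule A q) ∧
      IsRegularPrimeExtension p (residualSubmodule A q) C := by
  obtain ⟨rfl, hp, hpmax⟩ := isRegularPrimeExtension_iff.1 hAB
  obtain ⟨rfl, hq, hqmax⟩ := isRegularPrimeExtension_iff.1 hBC
  refine ⟨isRegularPrimeExtension_iff.2 ⟨rfl,
    associatedPrimes_quotient_residualSubmodule_subset A p hq,
    fun q' hq' hle => ?_⟩, isRegularPrimeExtension_iff.2 ⟨residualSubmodule_comm A p q,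
    mem_associatedPrimes_quotient_residualSubmodule hp hqp,
    fun p' hp' => hpmax p' (associatedPrimes_quotient_residualSubmodule_subset A q hp')⟩⟩
  refine hqmax q' (mem_associatedPrimes_quotient_residualSubmodule hq' fun hpq' => hqp ?_) hle
  exact hpmax q' hq' hpq' ▸ hle

end Residual

/-- Interchange lemma: if in an RPE filtration `p_{i+1} ⊈ p_i`, then the two
adjacent primes can be interchanged: there is a submodule `K_i` replacing `M_i`
such that the resulting chain is again an RPE filtration, with the primes at
positions `i` and `i+1` swapped. -/
theorem stmt_2 {R : Type*} [CommRing R] [IsNoetherianRing R]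
    {M : Type*} [AddCommGroup M] [Module R M] [Module.Finite R M]
    (N : Submodule R M) (hN : N ≠ ⊤) (n : ℕ)
    (F : Fin (n + 1) → Submodule R M) (p : Fin n → Ideal R)
    (hF : IsRPEFiltration N n F p)
    (i j : Fin n) (hij : (j : ℕ) = (i : ℕ) + 1) (h : ¬ p j ≤ p i) :
    ∃ K : Submodule R M,
      IsRegularPrimeExtension (p j) (F i.castSucc) K ∧
      IsRegularPrimeExtension (p i) K (F j.succ) ∧
      IsRPEFiltration N n (Function.update F i.succ K)
        (fun k => if k = i then p j else if k = j then p i else p k) := by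
  obtain ⟨hF0, hFlast, hreg⟩ := hF
  have hsucc : j.castSucc = i.succ := Fin.ext (by simpa using hij)
  have hBC := hreg j
  rw [hsucc] at hBC
  obtain ⟨h₁, h₂⟩ := (hreg i).interchange hBC h
  have hj : j.succ ≠ i.succ := fun e => by simp [Fin.ext_iff] at e; omega
  have hi : i.castSucc ≠ i.succ := fun e => by simp [Fin.ext_iff] at e
  have hji : j ≠ i := fun e => by simp [Fin.ext_iff] at e; omega
  refine ⟨residualSubmodule (F i.castSucc) (p j), h₁, h₂, ?_, ?_, fun k => ?_⟩
  · rwa [Function.update_of_ne (Fin.succ_ne_zero i).symm]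
  · rwa [Function.update_of_ne fun e => by simp [Fin.ext_iff] at e; omega]
  · by_cases hki : k = i
    · subst hki
      simpa [Function.update_of_ne hi] using h₁
    by_cases hkj : k = j
    · subst hkj
      rw [hsucc, Function.update_self, Function.update_of_ne hj]
      simpa [hji] using h₂
    · rw [Function.update_of_ne fun e => hkj (Fin.castSucc_injective n (e.trans hsucc.symm)),
        Function.update_of_ne fun e => hki (Fin.succ_injective n e)]
      simpa [hki, hkj] using hreg k
end
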